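/- The limiting kurtosis of the Gepner statistic on permutations equals 87/25: with m_r(n) the r-th central moment of gep over S_n, the sequence m_4(n)/m_2(n)² tends to 87/25 as n → ∞. In particular the limit is not 3, so the Gepner statistic on permutations is not asymptotically normal. -/

import Mathlib

/-- The Gepner statistic of a word `w = w 0 … w (m-1)` over a totally ordered
alphabet: the number of triples of positions `i < j < k` such that
`w_i w_j w_k` reduces to one of the odd permutations `132`, `213`, `321`. -/
def gep {m : ℕ} {α : Type*} [LinearOrder α] (w : Fin m → α) : ℕ :=
  (Finset.univ.filter (fun t : Fin m × Fin m × Fin m =>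
    t.1 < t.2.1 ∧ t.2.1 < t.2.2 ∧
      ((w t.1 < w t.2.2 ∧ w t.2.2 < w t.2.1) ∨
       (w t.2.1 < w t.1 ∧ w t.1 < w t.2.2) ∨
       (w t.2.2 < w t.2.1 ∧ w t.2.1 < w t.1)))).card

/-- The `r`-th central moment of the Gepner statistic over permutations
of `{1,…,n}`, i.e. `(1/n!) ∑_{π ∈ S_n} (gep(π) − n(n−1)(n−2)/12)^r`,
viewed as a real number. -/
noncomputable def m (r n : ℕ) : ℝ :=
  (∑ π : Equiv.Perm (Fin n),
      ((gep (fun i => π i) : ℝ) - (n : ℝ) * ((n : ℝ) - 1) * ((n : ℝ) - 2) / 12) ^ r)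
    / (n.factorial : ℝ)

namespace Gep
open Finset

/-- sign of the comparison -/
noncomputable def sg {n : ℕ} (a b : Fin n) : ℝ := if a < b then 1 else if b < a then -1 else 0

/-- the sawtooth matrix -/
noncomputable def A {n : ℕ} (a b : Fin n) : ℝ := n * sg a b - 2 * ((b : ℕ) - (a : ℕ) : ℝ)

lemma sg_antisymm {n : ℕ} (a b : Fin n) : sg b a = - sg a b := by
  unfold sg
  rcases lt_trichotomy a b with h | h | h
  · simp [h, h.not_gt]
  · simp [h]
  · simp [h, h.not_gt]

lemma A_antisymm {n : ℕ} (a b : Fin n) : A b a = - A a b := by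
  unfold A; rw [sg_antisymm]; ring

lemma A_self {n : ℕ} (a : Fin n) : A a a = 0 := by simp [A, sg]

lemma abs_A_le {n : ℕ} (a b : Fin n) : |A a b| ≤ n := by
  have ha : ((a : ℕ) : ℝ) + 1 ≤ n := by exact_mod_cast a.2
  have hb : ((b : ℕ) : ℝ) + 1 ≤ n := by exact_mod_cast b.2
  have ha0 : (0 : ℝ) ≤ ((a : ℕ) : ℝ) := by positivity
  have hb0 : (0 : ℝ) ≤ ((b : ℕ) : ℝ) := by positivity
  unfold A sg
  rcases lt_trichotomy a b with h | h | h
  · have : ((a : ℕ) : ℝ) < (b : ℕ) := by exact_mod_cast h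
    simp only [h, if_true]; rw [abs_le]; constructor <;> linarith
  · subst h; simp
  · have : ((b : ℕ) : ℝ) < (a : ℕ) := by exact_mod_cast h
    simp only [h, h.not_gt, if_true, if_false]; rw [abs_le]; constructor <;> linarith

lemma sum_lt {n : ℕ} (a : Fin n) : ∑ b : Fin n, (if a < b then (1 : ℝ) else 0) = n - 1 - (a : ℕ) := by
  rw [Finset.sum_boole]
  have : (univ.filter (fun b => a < b)) = Finset.Ioi a := by ext; simp
  rw [this, Fin.card_Ioi, Nat.sub_sub, Nat.cast_sub (by have := a.2; omega)]
  push_cast; ring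

lemma sum_gt {n : ℕ} (a : Fin n) : ∑ b : Fin n, (if b < a then (1 : ℝ) else 0) = (a : ℕ) := by
  rw [Finset.sum_boole]
  have : (univ.filter (fun b => b < a)) = Finset.Iio a := by ext; simp
  rw [this, Fin.card_Iio]

lemma sum_between {n : ℕ} (a c : Fin n) :
    ∑ b : Fin n, (if a < b ∧ b < c then (1 : ℝ) else 0)
      = if a < c then ((c : ℕ) : ℝ) - (a : ℕ) - 1 else 0 := by
  rw [Finset.sum_boole]
  have : (univ.filter (fun b => a < b ∧ b < c)) = Finset.Ioo a c := by ext; simp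
  rw [this, Fin.card_Ioo]
  split_ifs with h
  · have : (a : ℕ) < c := h
    rw [Nat.sub_sub, Nat.cast_sub (by omega)]
    push_cast; ring
  · have : (c : ℕ) ≤ a := by simpa using h
    simp; omega

lemma sum_id (n : ℕ) : ∑ b : Fin n, ((b : ℕ) : ℝ) = n * (n - 1) / 2 := by
  rw [Fin.sum_univ_eq_sum_range (fun i => (i : ℝ))]
  induction n with
  | zero => simp
  | succ k ih => rw [sum_range_succ, ih]; push_cast; ring

lemma sum_sq_id (n : ℕ) : ∑ b : Fin n, ((b : ℕ) : ℝ) ^ 2 = n * (n - 1) * (2 * n - 1) / 6 := by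
  rw [Fin.sum_univ_eq_sum_range (fun i => (i : ℝ) ^ 2)]
  induction n with
  | zero => simp
  | succ k ih => rw [sum_range_succ, ih]; push_cast; ring

lemma sg_eq {n : ℕ} (a b : Fin n) :
    sg a b = (if a < b then (1 : ℝ) else 0) - (if b < a then (1 : ℝ) else 0) := by
  unfold sg
  rcases lt_trichotomy a b with h | h | h
  · simp [h, h.not_gt]
  · simp [h]
  · simp [h, h.not_gt]

lemma row_sum {n : ℕ} (a : Fin n) : ∑ b : Fin n, A a b = 0 := by
  have : ∀ b : Fin n, A a b = n * ((if a < b then (1 : ℝ) else 0) - (if b < a then (1 : ℝ) else 0))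
      - 2 * (b : ℕ) + 2 * (a : ℕ) := by
    intro b; unfold A; rw [sg_eq]; ring
  simp_rw [this]
  rw [sum_add_distrib, sum_sub_distrib, ← mul_sum, ← mul_sum, sum_sub_distrib, sum_lt, sum_gt,
    sum_id]
  simp
  ring

lemma col_sum {n : ℕ} (b : Fin n) : ∑ a : Fin n, A a b = 0 := by
  have := row_sum b
  have h : ∑ a : Fin n, A a b = - ∑ a : Fin n, A b a := by
    rw [← sum_neg_distrib]; exact sum_congr rfl (fun a _ => A_antisymm _ _)
  rw [h, this, neg_zero]

/-- the bilinear statistic -/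
noncomputable def T {n : ℕ} (π : Equiv.Perm (Fin n)) : ℝ :=
  ∑ a : Fin n, ∑ b : Fin n, A a b * A (π a) (π b)

lemma T_eq {n : ℕ} (π : Equiv.Perm (Fin n)) :
    T π = n * ∑ a : Fin n, ∑ b : Fin n, A a b * sg (π a) (π b) := by
  have h1 : ∀ a b : Fin n, A a b * A (π a) (π b) = n * (A a b * sg (π a) (π b))
      - 2 * (A a b * ((π b : ℕ) : ℝ)) + 2 * (A a b * ((π a : ℕ) : ℝ)) := by
    intro a b
    conv_lhs => rw [show A (π a) (π b) = n * sg (π a) (π b) - 2 * ((π b : ℕ) - (π a : ℕ) : ℝ) from rfl]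
    ring
  unfold T
  simp_rw [h1, sum_add_distrib, sum_sub_distrib, ← mul_sum]
  have h2 : ∑ a : Fin n, ∑ b : Fin n, A a b * ((π b : ℕ) : ℝ) = 0 := by
    rw [sum_comm]
    apply sum_eq_zero; intro b _
    rw [← sum_mul, col_sum, zero_mul]
  have h3 : ∑ a : Fin n, ∑ b : Fin n, A a b * ((π a : ℕ) : ℝ) = 0 := by
    apply sum_eq_zero; intro b _
    rw [← sum_mul, row_sum, zero_mul]
  rw [h2, h3]; ring

lemma T_eq2 {n : ℕ} (π : Equiv.Perm (Fin n)) :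
    T π = 2 * n * ∑ a : Fin n, ∑ b : Fin n,
      (if a < b then ((n : ℝ) - 2 * ((b : ℕ) - (a : ℕ) : ℝ)) * sg (π a) (π b) else 0) := by
  rw [T_eq]
  have h : ∀ a b : Fin n, A a b * sg (π a) (π b) =
    (if a < b then ((n : ℝ) - 2 * ((b : ℕ) - (a : ℕ) : ℝ)) * sg (π a) (π b) else 0) +
    (if b < a then ((n : ℝ) - 2 * ((a : ℕ) - (b : ℕ) : ℝ)) * sg (π b) (π a) else 0) := by
    intro a b
    rcases lt_trichotomy a b with h | h | h
    · simp [A, sg, h, h.not_gt]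
    · simp [A, sg, h]
    · rw [sg_antisymm (π a) (π b)]
      simp only [A, sg_eq, h, h.not_gt, if_true, if_false]; ring
  simp_rw [h, sum_add_distrib]
  rw [sum_comm (f := fun a b : Fin n => (if b < a then ((n : ℝ) - 2 * ((a : ℕ) - (b : ℕ) : ℝ)) * sg (π b) (π a) else 0))]
  ring

lemma gep_ind {n : ℕ} (w : Fin n → Fin n) (hw : Function.Injective w) (i j k : Fin n) :
    (if i < j ∧ j < k ∧
      ((w i < w k ∧ w k < w j) ∨ (w j < w i ∧ w i < w k) ∨ (w k < w j ∧ w j < w i))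
      then (1 : ℝ) else 0) =
    (if i < j then (1 : ℝ) else 0) * (if j < k then (1 : ℝ) else 0) *
      ((1 - (sg (w i) (w j) + sg (w j) (w k) - sg (w i) (w k))) / 2) := by
  by_cases h1 : i < j
  · by_cases h2 : j < k
    · have e1 : w i ≠ w j := fun h => h1.ne (hw h)
      have e2 : w j ≠ w k := fun h => h2.ne (hw h)
      have e3 : w i ≠ w k := fun h => (h1.trans h2).ne (hw h)
      generalize w i = a at *
      generalize w j = b at *
      generalize w k = c at *
      simp only [h1, h2, true_and, if_true, one_mul, sg]
      rcases lt_or_gt_of_ne e1 with q1 | q1 <;> rcases lt_or_gt_of_ne e2 with q2 | q2 <;>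
        rcases lt_or_gt_of_ne e3 with q3 | q3 <;>
        simp only [q1, q2, q3, q1.not_gt, q2.not_gt, q3.not_gt, if_true, if_false, true_and,
          false_and, or_false, false_or, and_false, and_true, or_true, true_or, or_self, and_self] <;>
        first
          | (norm_num; done)
          | (exfalso; exact absurd (q1.trans q2) q3.not_gt)
          | (exfalso; exact absurd (q2.trans q1) q3.not_gt)
    · simp [h2]
  · simp [h1]

lemma triple_sum {n : ℕ} (f : Fin n → Fin n → ℝ) :
    ∑ i : Fin n, ∑ j : Fin n, ∑ k : Fin n,
      (if i < j then (1 : ℝ) else 0) * (if j < k then (1 : ℝ) else 0) * (f i j + f j k - f i k)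
    = ∑ a : Fin n, ∑ b : Fin n,
      (if a < b then ((n : ℝ) - 2 * ((b : ℕ) - (a : ℕ) : ℝ)) * f a b else 0) := by
  simp_rw [mul_sub, mul_add, sum_sub_distrib, sum_add_distrib]
  have h1 : ∑ i : Fin n, ∑ j : Fin n, ∑ k : Fin n,
      (if i < j then (1 : ℝ) else 0) * (if j < k then (1 : ℝ) else 0) * f i j
      = ∑ a : Fin n, ∑ b : Fin n, (if a < b then ((n : ℝ) - 1 - (b : ℕ)) * f a b else 0) := by
    refine sum_congr rfl fun i _ => sum_congr rfl fun j _ => ?_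
    rw [← sum_mul, ← mul_sum, sum_lt]; split_ifs <;> ring
  have h2 : ∑ i : Fin n, ∑ j : Fin n, ∑ k : Fin n,
      (if i < j then (1 : ℝ) else 0) * (if j < k then (1 : ℝ) else 0) * f j k
      = ∑ a : Fin n, ∑ b : Fin n, (if a < b then ((a : ℕ) : ℝ) * f a b else 0) := by
    rw [sum_comm]
    refine sum_congr rfl fun j _ => ?_
    rw [sum_comm]
    refine sum_congr rfl fun k _ => ?_
    rw [← sum_mul, ← sum_mul, sum_gt]; split_ifs <;> ring
  have h3 : ∑ i : Fin n, ∑ j : Fin n, ∑ k : Fin n,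
      (if i < j then (1 : ℝ) else 0) * (if j < k then (1 : ℝ) else 0) * f i k
      = ∑ a : Fin n, ∑ b : Fin n, (if a < b then (((b : ℕ) : ℝ) - (a : ℕ) - 1) * f a b else 0) := by
    refine sum_congr rfl fun i _ => ?_
    rw [sum_comm]
    refine sum_congr rfl fun k _ => ?_
    rw [← sum_mul]
    have : ∀ j : Fin n, (if i < j then (1 : ℝ) else 0) * (if j < k then (1 : ℝ) else 0)
      = if i < j ∧ j < k then (1 : ℝ) else 0 := by
      intro j; by_cases h : i < j <;> simp [h]
    simp_rw [this]
    rw [sum_between]; split_ifs <;> ring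
  rw [h1, h2, h3, ← sum_add_distrib, ← sum_sub_distrib]
  refine sum_congr rfl fun i _ => ?_
  rw [← sum_add_distrib, ← sum_sub_distrib]
  refine sum_congr rfl fun k _ => ?_
  split_ifs <;> ring

lemma count_triples (n : ℕ) :
    ∑ i : Fin n, ∑ j : Fin n, ∑ k : Fin n,
      (if i < j then (1 : ℝ) else 0) * (if j < k then (1 : ℝ) else 0)
      = n * (n - 1) * (n - 2) / 6 := by
  simp_rw [← mul_sum, sum_lt]
  rw [sum_comm]
  simp_rw [← sum_mul, sum_gt]
  have : ∀ x : Fin n, ((x : ℕ) : ℝ) * ((n : ℝ) - 1 - (x : ℕ)) =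
    ((n : ℝ) - 1) * (x : ℕ) - ((x : ℕ) : ℝ) ^ 2 := by intro x; ring
  simp_rw [this, sum_sub_distrib, ← mul_sum, sum_id, sum_sq_id]
  ring

lemma gep_eq {n : ℕ} (hn : 0 < n) (π : Equiv.Perm (Fin n)) :
    (gep (fun i => π i) : ℝ) - (n : ℝ) * ((n : ℝ) - 1) * ((n : ℝ) - 2) / 12
      = - T π / (4 * n) := by
  have hn' : (n : ℝ) ≠ 0 := by positivity
  have h1 : (gep (fun i => π i) : ℝ) = ∑ i : Fin n, ∑ j : Fin n, ∑ k : Fin n,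
    (if i < j then (1 : ℝ) else 0) * (if j < k then (1 : ℝ) else 0) *
      ((1 - (sg (π i) (π j) + sg (π j) (π k) - sg (π i) (π k))) / 2) := by
    unfold gep
    rw [← Finset.sum_boole, Fintype.sum_prod_type]
    refine sum_congr rfl fun i _ => ?_
    rw [Fintype.sum_prod_type]
    refine sum_congr rfl fun j _ => sum_congr rfl fun k _ => ?_
    exact gep_ind _ π.injective i j k
  have h2 : ∀ i j k : Fin n, (if i < j then (1 : ℝ) else 0) * (if j < k then (1 : ℝ) else 0) *
      ((1 - (sg (π i) (π j) + sg (π j) (π k) - sg (π i) (π k))) / 2) =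
      (1 / 2) * ((if i < j then (1 : ℝ) else 0) * (if j < k then (1 : ℝ) else 0)) -
      (1 / 2) * ((if i < j then (1 : ℝ) else 0) * (if j < k then (1 : ℝ) else 0) *
       (sg (π i) (π j) + sg (π j) (π k) - sg (π i) (π k))) := by intros; ring
  rw [h1, T_eq2]
  simp_rw [h2, sum_sub_distrib, ← mul_sum]
  have hc := count_triples n
  simp_rw [← mul_sum] at hc
  rw [hc, triple_sum (fun a b => sg (π a) (π b))]
  field_simp
  ring

end Gep
namespace Gep
open Finset

/-- half-edges -/
abbrev H (r : ℕ) := Fin r × Bool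

/-- product over the edges -/
noncomputable def F {r n : ℕ} (x : H r → Fin n) : ℝ := ∏ e : Fin r, A (x (e, false)) (x (e, true))

noncomputable instance (r : ℕ) : Fintype (Setoid (H r)) :=
  haveI : Finite (Setoid (H r)) :=
    Finite.of_injective (fun s : Setoid (H r) => (fun i j => s i j : H r → H r → Prop))
      (fun s t h => Setoid.ext fun i j => iff_of_eq (congrFun (congrFun h i) j))
  Fintype.ofFinite _

open Classical in
/-- tuples with a given kernel -/
noncomputable def K {r : ℕ} (n : ℕ) (P : Setoid (H r)) : Finset (H r → Fin n) :=
  univ.filter (fun x => Setoid.ker x = P)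

lemma mem_K {r n : ℕ} {P : Setoid (H r)} {x : H r → Fin n} : x ∈ K n P ↔ Setoid.ker x = P := by
  simp [K]

/-- sum of products over tuples with a given kernel -/
noncomputable def S {r : ℕ} (n : ℕ) (P : Setoid (H r)) : ℝ := ∑ x ∈ K n P, F x

/-- splitting a tuple of half-edges -/
def splitEquiv (r : ℕ) (α : Type) : (H r → α) ≃ (Fin r → α × α) where
  toFun x := fun e => (x (e, false), x (e, true))
  invFun p := fun h => if h.2 then (p h.1).2 else (p h.1).1
  left_inv x := by ext ⟨e, b⟩; cases b <;> simp
  right_inv p := by ext e <;> simp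

lemma T_pow {n : ℕ} (r : ℕ) (π : Equiv.Perm (Fin n)) :
    T π ^ r = ∑ x : H r → Fin n, F x * F (π ∘ x) := by
  unfold T
  rw [← Fintype.sum_prod_type' (fun a b => A a b * A (π a) (π b)), Fintype.sum_pow]
  symm
  refine Fintype.sum_equiv (splitEquiv r (Fin n)) _ _ fun x => ?_
  simp [F, splitEquiv, Finset.prod_mul_distrib]

lemma exists_perm {r n : ℕ} {x y : H r → Fin n} (h : Setoid.ker x = Setoid.ker y) :
    ∃ π : Equiv.Perm (Fin n), π ∘ x = y := by
  have h' : ∀ i j, x i = x j ↔ y i = y j := fun i j => by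
    have := congrArg (fun s : Setoid (H r) => s i j) h
    simpa [Setoid.ker_def] using this
  classical
  let f : {a // a ∈ Set.range x} → {a // a ∈ Set.range y} := fun a => ⟨y a.2.choose, ⟨_, rfl⟩⟩
  have hf : ∀ i, f ⟨x i, ⟨i, rfl⟩⟩ = ⟨y i, ⟨i, rfl⟩⟩ := by
    intro i
    apply Subtype.ext
    exact (h' _ _).1 (Set.mem_range_self (f := x) i).choose_spec
  have hb : Function.Bijective f := by
    constructor
    · rintro ⟨_, i, rfl⟩ ⟨_, j, rfl⟩ hij
      rw [hf, hf] at hij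
      apply Subtype.ext
      exact (h' _ _).2 (congrArg Subtype.val hij)
    · rintro ⟨_, i, rfl⟩
      exact ⟨_, hf i⟩
  refine ⟨(Equiv.ofBijective f hb).extendSubtype, ?_⟩
  ext i
  have := Equiv.extendSubtype_apply_of_mem (Equiv.ofBijective f hb) (x i) ⟨i, rfl⟩
  simp only [Function.comp]
  rw [this, Equiv.ofBijective_apply, hf]

lemma ker_perm_comp {r n : ℕ} (π : Equiv.Perm (Fin n)) (x : H r → Fin n) :
    Setoid.ker (π ∘ x) = Setoid.ker x := by
  ext i j; simp [Setoid.ker_def]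

lemma sum_perm_K {r n : ℕ} (P : Setoid (H r)) (π : Equiv.Perm (Fin n)) (φ : (H r → Fin n) → ℝ) :
    ∑ x ∈ K n P, φ (π ∘ x) = ∑ x ∈ K n P, φ x := by
  refine Finset.sum_equiv (Equiv.arrowCongr (Equiv.refl (H r)) π) ?_ ?_
  · intro x
    rw [mem_K, mem_K]
    have : (Equiv.arrowCongr (Equiv.refl (H r)) π) x = π ∘ x := by ext; simp
    rw [this, ker_perm_comp]
  · intro x _
    have : (Equiv.arrowCongr (Equiv.refl (H r)) π) x = π ∘ x := by ext; simp
    rw [this]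

lemma avg {r n : ℕ} (P : Setoid (H r)) (φ : (H r → Fin n) → ℝ) (x : H r → Fin n) (hx : x ∈ K n P) :
    ((K n P).card : ℝ) * ∑ π : Equiv.Perm (Fin n), φ (π ∘ x)
      = (n.factorial : ℝ) * ∑ y ∈ K n P, φ y := by
  have h1 : ∀ y ∈ K n P, ∑ π : Equiv.Perm (Fin n), φ (π ∘ y) = ∑ π : Equiv.Perm (Fin n), φ (π ∘ x) := by
    intro y hy
    obtain ⟨σ, hσ⟩ := exists_perm ((mem_K.1 hx).trans (mem_K.1 hy).symm)
    refine Fintype.sum_equiv (Equiv.mulRight σ) _ _ fun π => ?_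
    rw [← hσ]; rfl
  have h2 := Finset.sum_congr (rfl : K n P = K n P) h1
  rw [Finset.sum_const, nsmul_eq_mul] at h2
  rw [← h2, Finset.sum_comm]
  simp_rw [sum_perm_K]
  rw [Finset.sum_const, nsmul_eq_mul, Finset.card_univ, Fintype.card_perm, Fintype.card_fin]

lemma moment_eq (r n : ℕ) :
    (∑ π : Equiv.Perm (Fin n), T π ^ r) / (n.factorial : ℝ)
      = ∑ P : Setoid (H r), S n P ^ 2 / ((K n P).card : ℝ) := by
  classical
  have hf : (n.factorial : ℝ) ≠ 0 := by positivity
  simp_rw [T_pow]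
  rw [Finset.sum_comm]
  simp_rw [← Finset.mul_sum]
  rw [← Finset.sum_fiberwise (s := univ) (g := fun x : H r → Fin n => Setoid.ker x), Finset.sum_div]
  refine Finset.sum_congr rfl fun P _ => ?_
  have hK : (univ.filter (fun x : H r → Fin n => Setoid.ker x = P)) = K n P := by
    ext x; simp [mem_K]
  rw [hK]
  by_cases h0 : (K n P).card = 0
  · rw [Finset.card_eq_zero] at h0; simp [h0]
  have h0' : ((K n P).card : ℝ) ≠ 0 := by exact_mod_cast h0
  have : ∀ x ∈ K n P, F x * ∑ π : Equiv.Perm (Fin n), F (π ∘ x)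
     = F x * ((n.factorial : ℝ) * S n P / ((K n P).card : ℝ)) := by
    intro x hx
    have := avg P F x hx
    congr 1
    rw [eq_div_iff h0', mul_comm, this]; rfl
  rw [Finset.sum_congr rfl this, ← Finset.sum_mul]
  change S n P * _ / _ = _
  field_simp

lemma m_eq (r n : ℕ) (hn : 0 < n) :
    m r n = (-1 / (4 * n)) ^ r * ∑ P : Setoid (H r), S n P ^ 2 / ((K n P).card : ℝ) := by
  rw [← moment_eq]
  unfold m
  simp_rw [gep_eq hn]
  rw [← mul_div_assoc, Finset.mul_sum]
  congr 1
  refine Finset.sum_congr rfl fun π _ => ?_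
  rw [← mul_pow]; congr 1; ring

/-- number of classes -/
noncomputable def cl {r : ℕ} (P : Setoid (H r)) : ℕ := Nat.card (Quotient P)

lemma card_K {r : ℕ} (n : ℕ) (P : Setoid (H r)) : (K n P).card = n.descFactorial (cl P) := by
  classical
  have e : {x : H r → Fin n // Setoid.ker x = P} ≃ (Quotient P ↪ Fin n) :=
    { toFun := fun x => ⟨Quotient.lift x.1 (fun a b h => by
          have h' : P a b := h
          rw [← x.2] at h'; exact h'), by
          rintro ⟨a⟩ ⟨b⟩ hab
          apply Quotient.sound
          change P a b
          rw [← x.2]; exact hab⟩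
      invFun := fun f => ⟨fun i => f (Quotient.mk P i), by
          ext a b
          rw [Setoid.ker_def, f.apply_eq_iff_eq]
          exact Quotient.eq⟩
      left_inv := fun x => by ext; rfl
      right_inv := fun f => by
        ext q
        induction q using Quotient.inductionOn
        rfl }
  letI : Fintype (Quotient P) := Fintype.ofFinite _
  have h1 : (K n P).card = Fintype.card {x : H r → Fin n // Setoid.ker x = P} := by
    rw [Fintype.card_subtype]; unfold K; congr
  rw [h1, Fintype.card_congr e, Fintype.card_embedding_eq, Fintype.card_fin, cl,
    Nat.card_eq_fintype_card]

/-- singletons -/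
noncomputable def sing {r : ℕ} (P : Setoid (H r)) : Finset (H r) :=
  open Classical in univ.filter (fun i => ∀ j, P i j → j = i)

lemma mem_sing {r : ℕ} {P : Setoid (H r)} {i : H r} : i ∈ sing P ↔ ∀ j, P i j → j = i := by
  simp [sing]

lemma abs_F_le {r n : ℕ} (x : H r → Fin n) : |F x| ≤ (n : ℝ) ^ r := by
  unfold F
  rw [Finset.abs_prod]
  calc _ ≤ ∏ e : Fin r, (n : ℝ) := Finset.prod_le_prod (fun _ _ => abs_nonneg _) (fun _ _ => abs_A_le _ _)
    _ = _ := by simp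

lemma abs_S_le {r : ℕ} (n : ℕ) (P : Setoid (H r)) : |S n P| ≤ (n : ℝ) ^ (r + cl P) := by
  unfold S
  calc _ ≤ ∑ x ∈ K n P, |F x| := Finset.abs_sum_le_sum_abs _ _
    _ ≤ ∑ x ∈ K n P, (n : ℝ) ^ r := Finset.sum_le_sum fun x _ => abs_F_le x
    _ = ((K n P).card : ℝ) * (n : ℝ) ^ r := by simp
    _ ≤ (n : ℝ) ^ cl P * (n : ℝ) ^ r := by
        gcongr
        rw [card_K]
        exact_mod_cast Nat.descFactorial_le_pow _ _
    _ = _ := by rw [pow_add, mul_comm]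

/-- the two setoids agree away from `v` -/
def Agree {r : ℕ} (v : H r) (P Q : Setoid (H r)) : Prop := ∀ i j, i ≠ v → j ≠ v → (P i j ↔ Q i j)

lemma agree_cl {r : ℕ} {v : H r} {P Q : Setoid (H r)} (hv : v ∈ sing P) (h : Agree v P Q)
    (hne : Q ≠ P) : ∃ u, u ≠ v ∧ Q v u := by
  by_contra hcon
  push Not at hcon
  have hcon' : ∀ u, Q v u → u = v := fun u hu => by
    by_contra h'; exact hcon u h' hu
  apply hne
  ext i j
  rw [mem_sing] at hv
  by_cases hi : i = v
  · subst hi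
    constructor
    · intro hq; rw [hcon' j hq]
    · intro hq; rw [hv j hq]
  · by_cases hj : j = v
    · subst hj
      constructor
      · intro hq; exact absurd (hcon' i (Q.symm' hq)) hi
      · intro hq; exact absurd (hv i (P.symm' hq)) hi
    · exact (h i j hi hj).symm

lemma cl_eq_card_image {r : ℕ} (P : Setoid (H r)) [DecidableEq (Quotient P)] :
    cl P = ((univ : Finset (H r)).image (Quotient.mk P)).card := by
  letI : Fintype (Quotient P) := Fintype.ofFinite _
  rw [cl, Nat.card_eq_fintype_card, ← Finset.card_univ]
  congr 1
  ext q
  induction q using Quotient.inductionOn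
  simp

lemma card_image_congr {ι α β : Type*} [DecidableEq α] [DecidableEq β] (s : Finset ι) (x : ι → α)
    (y : ι → β) (h : ∀ i ∈ s, ∀ j ∈ s, (x i = x j ↔ y i = y j)) :
    (s.image x).card = (s.image y).card := by
  classical
  refine Finset.card_bij (fun a ha => y (Finset.mem_image.1 ha).choose) ?_ ?_ ?_
  · intro a ha
    exact Finset.mem_image_of_mem _ (Finset.mem_image.1 ha).choose_spec.1
  · intro a ha b hb hab
    have h1 := (Finset.mem_image.1 ha).choose_spec
    have h2 := (Finset.mem_image.1 hb).choose_spec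
    rw [← h1.2, ← h2.2]
    exact (h _ h1.1 _ h2.1).2 hab
  · intro b hb
    obtain ⟨i, hi, rfl⟩ := Finset.mem_image.1 hb
    refine ⟨x i, Finset.mem_image_of_mem _ hi, ?_⟩
    have h1 := (Finset.mem_image.1 (Finset.mem_image_of_mem x hi)).choose_spec
    exact (h _ h1.1 _ hi).1 h1.2

lemma cl_lt {r : ℕ} {v : H r} {P Q : Setoid (H r)} (hv : v ∈ sing P) (h : Agree v P Q)
    (hne : Q ≠ P) : cl P = cl Q + 1 := by
  classical
  obtain ⟨u, huv, hu⟩ := agree_cl hv h hne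
  rw [cl_eq_card_image, cl_eq_card_image]
  have hu1 : (univ : Finset (H r)) = insert v (univ.erase v) := by simp
  rw [hu1, Finset.image_insert, Finset.image_insert, Finset.card_insert_of_notMem,
    Finset.insert_eq_of_mem]
  · congr 1
    apply card_image_congr
    intro i hi j hj
    rw [Quotient.eq, Quotient.eq]
    exact h i j (by simpa using hi) (by simpa using hj)
  · rw [Finset.mem_image]
    exact ⟨u, by simpa using huv, Quotient.sound (Q.symm' hu)⟩
  · rw [Finset.mem_image]
    rintro ⟨i, hi, hiv⟩
    have : P i v := Quotient.exact hiv
    have := mem_sing.1 hv i (P.symm' this)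
    simp [this] at hi

lemma sing_le {r : ℕ} {v : H r} {P Q : Setoid (H r)} (hv : v ∈ sing P) (h : Agree v P Q)
    (hne : Q ≠ P) : (sing P).card ≤ (sing Q).card + 2 := by
  classical
  obtain ⟨u, huv, hu⟩ := agree_cl hv h hne
  have : sing P ⊆ sing Q ∪ {v, u} := by
    intro i hi
    by_cases h1 : i = v
    · simp [h1]
    by_cases h2 : i = u
    · simp [h2]
    apply Finset.mem_union_left
    rw [mem_sing] at hi ⊢
    intro j hj
    by_cases h3 : j = v
    · subst h3
      have : Q i u := Q.trans' hj hu
      exact absurd (hi u ((h i u h1 huv).2 this)).symm h2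
    · exact hi j ((h i j h1 h3).2 hj)
  calc _ ≤ _ := Finset.card_le_card this
    _ ≤ _ := Finset.card_union_le _ _
    _ ≤ _ := by gcongr; exact Finset.card_le_two

/-- `F` summed over one coordinate vanishes -/
lemma sum_update_F {r n : ℕ} (v : H r) (x : H r → Fin n) :
    ∑ y : Fin n, F (Function.update x v y) = 0 := by
  obtain ⟨e, b⟩ := v
  unfold F
  have : ∀ y : Fin n, ∏ e' : Fin r, A (Function.update x (e, b) y (e', false))
      (Function.update x (e, b) y (e', true))
      = (if b then A (x (e, false)) y else A y (x (e, true))) *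
        ∏ e' ∈ univ.erase e, A (x (e', false)) (x (e', true)) := by
    intro y
    rw [← Finset.mul_prod_erase univ _ (Finset.mem_univ e)]
    congr 1
    · cases b <;> simp [Function.update_apply]
    · refine Finset.prod_congr rfl fun e' he' => ?_
      have : e' ≠ e := by simpa using he'
      simp [Function.update_apply, this]
  simp_rw [this]
  rw [← Finset.sum_mul]
  cases b <;> simp [row_sum, col_sum]

lemma sum_agree {r : ℕ} (n : ℕ) (v : H r) (P : Setoid (H r)) :
    open Classical in ∑ Q ∈ univ.filter (fun Q => Agree v P Q), S n Q = 0 := by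
  classical
  have h1 : ∑ Q ∈ univ.filter (fun Q => Agree v P Q), S n Q
      = ∑ x ∈ univ.filter (fun x : H r → Fin n => Agree v P (Setoid.ker x)), F x := by
    rw [← Finset.sum_fiberwise_of_maps_to (s := univ.filter (fun x : H r → Fin n => Agree v P (Setoid.ker x)))
      (t := univ.filter (fun Q => Agree v P Q)) (g := fun x => Setoid.ker x)]
    · refine Finset.sum_congr rfl fun Q hQ => ?_
      unfold S
      refine Finset.sum_congr ?_ fun _ _ => rfl
      ext x
      simp only [mem_K, Finset.mem_filter, Finset.mem_univ, true_and] at hQ ⊢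
      constructor
      · rintro rfl; exact ⟨hQ, rfl⟩
      · exact fun h => h.2
    · intro x hx; simpa using hx
  rw [h1, Finset.sum_filter]
  -- average over the coordinate v
  rcases Nat.eq_zero_or_pos n with hn | hn
  · subst hn
    haveI : IsEmpty (H r → Fin 0) := ⟨fun x => (x v).elim0⟩
    simp
  set G : (H r → Fin n) → ℝ := fun x => if Agree v P (Setoid.ker x) then F x else 0 with hG
  have hup : ∀ x y, G (Function.update x v y) = if Agree v P (Setoid.ker x) then F (Function.update x v y) else 0 := by
    intro x y
    have : Agree v P (Setoid.ker (Function.update x v y)) ↔ Agree v P (Setoid.ker x) := by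
      refine forall_congr' fun i => forall_congr' fun j => forall_congr' fun hi => forall_congr' fun hj => ?_
      rw [Setoid.ker_def, Setoid.ker_def, Function.update_of_ne hi, Function.update_of_ne hj]
    simp only [hG, this]
  have h0 : ∀ x, ∑ y : Fin n, G (Function.update x v y) = 0 := by
    intro x
    simp_rw [hup]
    split_ifs
    · exact sum_update_F v x
    · simp
  have e := Equiv.funSplitAt v (Fin n)
  have h3 : ∑ x, G x = ∑ p : (Fin n) × ({j // j ≠ v} → Fin n), G ((Equiv.funSplitAt v (Fin n)).symm p) :=
    Fintype.sum_equiv (Equiv.funSplitAt v (Fin n)) _ _ (fun x => by rw [Equiv.symm_apply_apply])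
  rw [h3, Fintype.sum_prod_type_right]
  refine Finset.sum_eq_zero fun z _ => ?_
  rw [← h0 ((Equiv.funSplitAt v (Fin n)).symm (⟨0, hn⟩, z))]
  refine Finset.sum_congr rfl fun y _ => ?_
  congr 1
  ext i
  by_cases hi : i = v
  · subst hi; simp
  · simp [Function.update_apply, hi]

lemma S_bound {r : ℕ} : ∀ (c : ℕ) (P : Setoid (H r)) (w : ℕ), cl P = c → 2 * cl P ≤ w + (sing P).card →
    ∃ C : ℝ, 0 ≤ C ∧ ∀ n : ℕ, 0 < n → S n P ^ 2 ≤ C * (n : ℝ) ^ (2 * r + w) := by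
  classical
  intro c
  induction c with
  | zero =>
    intro P w hc hw
    refine ⟨1, zero_le_one, fun n hn => ?_⟩
    rw [← sq_abs, one_mul]
    calc _ ≤ ((n : ℝ) ^ (r + cl P)) ^ 2 := by gcongr; exact abs_S_le n P
      _ = (n : ℝ) ^ (2 * r) := by rw [hc, ← pow_mul]; congr 1; ring
      _ ≤ _ := pow_le_pow_right₀ (by exact_mod_cast hn) (by omega)
  | succ c ih =>
    intro P w hc hw
    rcases (sing P).eq_empty_or_nonempty with hs | ⟨v, hv⟩
    · rw [hs, Finset.card_empty] at hw
      refine ⟨1, zero_le_one, fun n hn => ?_⟩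
      rw [← sq_abs, one_mul]
      calc _ ≤ ((n : ℝ) ^ (r + cl P)) ^ 2 := by gcongr; exact abs_S_le n P
        _ = (n : ℝ) ^ (2 * r + 2 * cl P) := by rw [← pow_mul]; congr 1; ring
        _ ≤ _ := pow_le_pow_right₀ (by exact_mod_cast hn) (by omega)
    · set B := (univ.filter (fun Q => Agree v P Q)).erase P with hB
      have hex : ∀ Q : Setoid (H r), ∃ C : ℝ, 0 ≤ C ∧ (Q ∈ B → ∀ n : ℕ, 0 < n → S n Q ^ 2 ≤ C * (n : ℝ) ^ (2 * r + w)) := by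
        intro Q
        by_cases hQ : Q ∈ B
        · have hQ' : Q ≠ P ∧ Agree v P Q := by simpa [hB] using hQ
          have h1 := cl_lt hv hQ'.2 hQ'.1
          have h2 := sing_le hv hQ'.2 hQ'.1
          obtain ⟨C, hC, hC'⟩ := ih Q w (by omega) (by omega)
          exact ⟨C, hC, fun _ => hC'⟩
        · exact ⟨0, le_rfl, fun h => absurd h hQ⟩
      choose C hC0 hC using hex
      refine ⟨B.card * ∑ Q ∈ B, C Q, mul_nonneg (by positivity) (Finset.sum_nonneg fun Q _ => hC0 Q), fun n hn => ?_⟩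
      have hsum := sum_agree n v P
      have hP : P ∈ univ.filter (fun Q => Agree v P Q) := by
        simp only [Finset.mem_filter, Finset.mem_univ, true_and]
        exact fun i j _ _ => Iff.rfl
      have hS : S n P = - ∑ Q ∈ B, S n Q := by
        rw [← Finset.add_sum_erase _ _ hP] at hsum
        linarith
      rw [hS, neg_sq]
      calc _ ≤ (B.card : ℝ) * ∑ Q ∈ B, S n Q ^ 2 := sq_sum_le_card_mul_sum_sq
        _ ≤ (B.card : ℝ) * ∑ Q ∈ B, C Q * (n : ℝ) ^ (2 * r + w) := by
            gcongr with Q hQ; exact hC Q hQ n hn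
        _ = _ := by rw [← Finset.sum_mul]; ring

end Gep
namespace Gep
open Finset Filter Topology

lemma fiber_card {r : ℕ} (P : Setoid (H r)) :
    2 * cl P ≤ 2 * r + (sing P).card := by
  classical
  letI : Fintype (Quotient P) := Fintype.ofFinite _
  have h1 : (univ : Finset (H r)).card = ∑ q : Quotient P, (univ.filter (fun i => Quotient.mk P i = q)).card :=
    Finset.card_eq_sum_card_fiberwise (fun i _ => Finset.mem_univ _)
  have h2 : (sing P).card = ∑ q : Quotient P, ((sing P).filter (fun i => Quotient.mk P i = q)).card :=
    Finset.card_eq_sum_card_fiberwise (fun i _ => Finset.mem_univ _)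
  have h3 : (univ : Finset (H r)).card = 2 * r := by
    rw [Finset.card_univ, Fintype.card_prod, Fintype.card_fin, Fintype.card_bool, mul_comm]
  rw [← h3, h1, h2, ← Finset.sum_add_distrib]
  have h4 : 2 * cl P = ∑ q : Quotient P, 2 := by
    rw [Finset.sum_const, Finset.card_univ, cl, Nat.card_eq_fintype_card, smul_eq_mul, mul_comm]
  rw [h4]
  refine Finset.sum_le_sum fun q _ => ?_
  induction q using Quotient.inductionOn with | _ i => ?_
  have hi : i ∈ univ.filter (fun j => Quotient.mk P j = Quotient.mk P i) := by simp
  by_cases hs : i ∈ sing P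
  · have : i ∈ (sing P).filter (fun j => Quotient.mk P j = Quotient.mk P i) := by simp [hs]
    have h5 := Finset.card_pos.2 ⟨i, hi⟩
    have h6 := Finset.card_pos.2 ⟨i, this⟩
    omega
  · rw [mem_sing] at hs
    push Not at hs
    obtain ⟨j, hj, hji⟩ := hs
    have hj' : j ∈ univ.filter (fun j => Quotient.mk P j = Quotient.mk P i) := by
      simp only [Finset.mem_filter, Finset.mem_univ, true_and]
      exact Quotient.sound (P.symm' hj)
    have := Finset.one_lt_card.2 ⟨j, hj', i, hi, hji⟩
    omega

lemma pairing_of_not_lt {r : ℕ} (P : Setoid (H r)) (h : ¬ cl P < r + (sing P).card) :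
    cl P = r ∧ ∃ σ : H r → H r, (∀ i, σ i ≠ i) ∧ ∀ i j, P i j ↔ (j = i ∨ j = σ i) := by
  classical
  have h0 := fiber_card P
  have hs : (sing P).card = 0 := by omega
  have hc : cl P = r := by omega
  refine ⟨hc, ?_⟩
  letI : Fintype (Quotient P) := Fintype.ofFinite _
  have h1 : (univ : Finset (H r)).card = ∑ q : Quotient P, (univ.filter (fun i => Quotient.mk P i = q)).card :=
    Finset.card_eq_sum_card_fiberwise (fun i _ => Finset.mem_univ _)
  have h3 : (univ : Finset (H r)).card = 2 * r := by
    rw [Finset.card_univ, Fintype.card_prod, Fintype.card_fin, Fintype.card_bool, mul_comm]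
  have h4 : 2 * cl P = ∑ q : Quotient P, 2 := by
    rw [Finset.sum_const, Finset.card_univ, cl, Nat.card_eq_fintype_card, smul_eq_mul, mul_comm]
  have h5 : ∀ q ∈ (univ : Finset (Quotient P)), 2 ≤ (univ.filter (fun i => Quotient.mk P i = q)).card := by
    intro q _
    induction q using Quotient.inductionOn with | _ i => ?_
    have hi : i ∈ univ.filter (fun j => Quotient.mk P j = Quotient.mk P i) := by simp
    have hs : i ∉ sing P := by
      rw [Finset.card_eq_zero] at hs; simp [hs]
    rw [mem_sing] at hs
    push Not at hs
    obtain ⟨j, hj, hji⟩ := hs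
    have hj' : j ∈ univ.filter (fun j => Quotient.mk P j = Quotient.mk P i) := by
      simp only [Finset.mem_filter, Finset.mem_univ, true_and]
      exact Quotient.sound (P.symm' hj)
    exact Finset.one_lt_card.2 ⟨j, hj', i, hi, hji⟩
  have h6 : ∑ q : Quotient P, 2 = ∑ q : Quotient P, (univ.filter (fun i => Quotient.mk P i = q)).card := by
    rw [← h4, ← h1, h3, hc]
  have h7 := (Finset.sum_eq_sum_iff_of_le h5).1 h6
  have h8 : ∀ i : H r, ∃ k, k ≠ i ∧ ∀ j, P i j ↔ (j = i ∨ j = k) := by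
    intro i
    obtain ⟨a, b, hab, hset⟩ := Finset.card_eq_two.1 (h7 (Quotient.mk P i) (Finset.mem_univ _)).symm
    have hm : ∀ j, P i j ↔ (j = a ∨ j = b) := by
      intro j
      have : j ∈ univ.filter (fun j => Quotient.mk P j = Quotient.mk P i) ↔ j ∈ ({a, b} : Finset (H r)) := by
        rw [hset]
      simp only [Finset.mem_filter, Finset.mem_univ, true_and, Finset.mem_insert,
        Finset.mem_singleton] at this
      rw [← this, P.comm']
      exact Quotient.eq.symm
    rcases (hm i).1 (P.refl' i) with hi | hi
    · subst hi; exact ⟨b, hab.symm, hm⟩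
    · subst hi; exact ⟨a, hab, fun j => by rw [hm j, or_comm]⟩
  choose σ h1 h2 using h8
  exact ⟨σ, h1, h2⟩

lemma K_ratio {r : ℕ} (P : Setoid (H r)) :
    Tendsto (fun n : ℕ => (n : ℝ) ^ cl P / ((K n P).card : ℝ)) atTop (𝓝 1) := by
  have h := isEquivalent_descFactorial (cl P)
  have h1 := (Asymptotics.isEquivalent_iff_tendsto_one ?_).1 h.symm
  · refine h1.congr fun n => ?_
    simp [card_K]
  · filter_upwards [eventually_ge_atTop (cl P)] with n hn
    have : n.descFactorial (cl P) ≠ 0 := by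
      rw [Ne, Nat.descFactorial_eq_zero_iff_lt]; omega
    exact_mod_cast this

lemma tendsto_nonpair {r : ℕ} (hr : 0 < r) (P : Setoid (H r)) (h : cl P < r + (sing P).card) :
    Tendsto (fun n : ℕ => S n P ^ 2 / ((K n P).card : ℝ) / (n : ℝ) ^ (3 * r)) atTop (𝓝 0) := by
  obtain ⟨C, hC0, hC⟩ := S_bound (cl P) P (r + cl P - 1) rfl (by omega)
  have h1 : Tendsto (fun n : ℕ => S n P ^ 2 / (n : ℝ) ^ (3 * r + cl P)) atTop (𝓝 0) := by
    refine squeeze_zero' (g := fun n : ℕ => C / (n : ℝ)) ?_ ?_ (tendsto_const_div_atTop_nhds_zero_nat C)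
    · exact Eventually.of_forall fun n => by positivity
    · filter_upwards [eventually_gt_atTop 0] with n hn
      have hn' : (0 : ℝ) < n := by exact_mod_cast hn
      rw [div_le_div_iff₀ (by positivity) hn']
      calc S n P ^ 2 * n ≤ C * (n : ℝ) ^ (2 * r + (r + cl P - 1)) * n := by
            gcongr; exact hC n hn
        _ = C * (n : ℝ) ^ (3 * r + cl P) := by
            rw [mul_assoc, ← pow_succ]; congr 2; omega
  have h2 := h1.mul (K_ratio P)
  rw [zero_mul] at h2
  refine h2.congr' ?_
  filter_upwards [eventually_gt_atTop 0] with n hn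
  have hn' : (n : ℝ) ≠ 0 := by positivity
  rw [pow_add]
  field_simp

lemma tendsto_pair {r : ℕ} (P : Setoid (H r)) (hc : cl P = r) (c : ℝ)
    (h : Tendsto (fun n : ℕ => S n P / (n : ℝ) ^ (2 * r)) atTop (𝓝 c)) :
    Tendsto (fun n : ℕ => S n P ^ 2 / ((K n P).card : ℝ) / (n : ℝ) ^ (3 * r)) atTop (𝓝 (c ^ 2)) := by
  have h2 := (h.pow 2).mul (K_ratio P)
  rw [mul_one] at h2
  refine h2.congr' ?_
  filter_upwards [eventually_gt_atTop 0] with n hn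
  have hn' : (n : ℝ) ≠ 0 := by positivity
  rw [hc, div_pow, ← pow_mul, show 2 * r * 2 = 3 * r + r by ring, pow_add]
  field_simp

lemma S_loop {r : ℕ} (n : ℕ) (P : Setoid (H r)) (e : Fin r) (h : P (e, false) (e, true)) :
    S n P = 0 := by
  refine Finset.sum_eq_zero fun x hx => ?_
  rw [mem_K] at hx
  rw [← hx, Setoid.ker_def] at h
  refine Finset.prod_eq_zero (Finset.mem_univ e) ?_
  rw [h, A_self]

/-- symmetry: permute the edges and flip some of them -/
def gmap {r : ℕ} (p : Equiv.Perm (Fin r)) (f : Fin r → Bool) (h : H r) : H r := (p h.1, xor h.2 (f h.1))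

/-- the same as an equivalence -/
def gEquiv {r : ℕ} (p : Equiv.Perm (Fin r)) (f : Fin r → Bool) : H r ≃ H r where
  toFun := gmap p f
  invFun h := (p.symm h.1, xor h.2 (f (p.symm h.1)))
  left_inv h := by simp [gmap]
  right_inv h := by simp [gmap]

lemma F_gmap {r n : ℕ} (p : Equiv.Perm (Fin r)) (f : Fin r → Bool) (x : H r → Fin n) :
    F (x ∘ gmap p f) = (∏ e, (if f e then (-1 : ℝ) else 1)) * F x := by
  unfold F
  rw [← Equiv.prod_comp p (fun e => A (x (e, false)) (x (e, true))), ← Finset.prod_mul_distrib]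
  refine Finset.prod_congr rfl fun e _ => ?_
  cases hf : f e
  · simp [gmap, hf]
  · simp [gmap, hf, A_antisymm (x (p e, false))]

lemma S_gmap {r : ℕ} (n : ℕ) (p : Equiv.Perm (Fin r)) (f : Fin r → Bool) (v : H r → Fin r) :
    S n (Setoid.ker (v ∘ gmap p f)) ^ 2 = S n (Setoid.ker v) ^ 2 := by
  have h1 : S n (Setoid.ker (v ∘ gmap p f)) = (∏ e, (if f e then (-1 : ℝ) else 1)) * S n (Setoid.ker v) := by
    unfold S
    rw [Finset.mul_sum]
    symm
    refine Finset.sum_equiv (Equiv.arrowCongr (gEquiv p f).symm (Equiv.refl (Fin n))) ?_ ?_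
    · intro x
      rw [mem_K, mem_K]
      have : (Equiv.arrowCongr (gEquiv p f).symm (Equiv.refl (Fin n))) x = x ∘ gmap p f := by
        ext; simp [gEquiv]
      rw [this]
      constructor
      · intro h
        ext i j
        have := congrArg (fun s : Setoid (H r) => s (gmap p f i) (gmap p f j)) h
        simpa [Setoid.ker_def] using this
      · intro h
        ext i j
        obtain ⟨i, rfl⟩ := (gEquiv p f).surjective i
        obtain ⟨j, rfl⟩ := (gEquiv p f).surjective j
        have := congrArg (fun s : Setoid (H r) => s i j) h
        simpa [Setoid.ker_def, gEquiv] using this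
    · intro x _
      have : (Equiv.arrowCongr (gEquiv p f).symm (Equiv.refl (Fin n))) x = x ∘ gmap p f := by
        ext; simp [gEquiv]
      rw [this, F_gmap]
  rw [h1, mul_pow, ← Finset.prod_pow]
  have : ∀ e, (if f e then (-1 : ℝ) else 1) ^ 2 = 1 := fun e => by split_ifs <;> norm_num
  simp [this]

lemma cl_ker {r : ℕ} (v : H r → Fin r) (hv : Function.Surjective v) : cl (Setoid.ker v) = r := by
  rw [cl, Nat.card_congr (Setoid.quotientKerEquivOfSurjective v hv), Nat.card_eq_fintype_card, Fintype.card_fin]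

lemma card_K_gmap {r : ℕ} (n : ℕ) (p : Equiv.Perm (Fin r)) (f : Fin r → Bool) (v : H r → Fin r)
    (hv : Function.Surjective v) :
    (K n (Setoid.ker (v ∘ gmap p f))).card = (K n (Setoid.ker v)).card := by
  have h2 : cl (Setoid.ker (v ∘ gmap p f)) = r := cl_ker _ (hv.comp (gEquiv p f).surjective)
  rw [card_K, card_K, cl_ker _ hv, h2]

lemma cl_lt_of_lt {r : ℕ} {P Q : Setoid (H r)} (h : P ≤ Q) (hne : Q ≠ P) : cl Q < cl P := by
  classical
  letI : Fintype (Quotient P) := Fintype.ofFinite _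
  letI : Fintype (Quotient Q) := Fintype.ofFinite _
  rw [cl, cl, Nat.card_eq_fintype_card, Nat.card_eq_fintype_card]
  let f : Quotient P → Quotient Q := Setoid.map_of_le h
  have hs : Function.Surjective f := by
    intro q
    induction q using Quotient.inductionOn with | _ i => ?_
    exact ⟨Quotient.mk P i, rfl⟩
  refine Fintype.card_lt_of_surjective_not_injective f hs fun hi => hne ?_
  apply le_antisymm _ h
  intro i j hij
  exact Quotient.exact (hi (a₁ := Quotient.mk P i) (a₂ := Quotient.mk P j) (Quotient.sound hij))

lemma tendsto_S_of_full {r : ℕ} (v : H r → Fin r) (hv : Function.Surjective v) (c : ℝ)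
    (h : Tendsto (fun n : ℕ => (∑ y : Fin r → Fin n, F (y ∘ v)) / (n : ℝ) ^ (2 * r)) atTop (𝓝 c)) :
    Tendsto (fun n : ℕ => S n (Setoid.ker v) / (n : ℝ) ^ (2 * r)) atTop (𝓝 c) := by
  classical
  set P := Setoid.ker v with hP
  have hc : cl P = r := cl_ker v hv
  set B := (univ.filter (fun Q => P ≤ Q)).erase P with hB
  have h1 : ∀ n : ℕ, ∑ y : Fin r → Fin n, F (y ∘ v) = S n P + ∑ Q ∈ B, S n Q := by
    intro n
    rw [hB, Finset.add_sum_erase _ (fun Q => S n Q) (by simp)]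
    have h2 : ∑ y : Fin r → Fin n, F (y ∘ v)
        = ∑ x ∈ univ.filter (fun x : H r → Fin n => P ≤ Setoid.ker x), F x := by
      refine Finset.sum_bij (fun y _ => y ∘ v) ?_ ?_ ?_ ?_
      · intro y _
        simp only [Finset.mem_filter, Finset.mem_univ, true_and]
        intro i j hij
        have : v i = v j := hij
        simp [Setoid.ker_def, this]
      · intro y _ z _ hyz
        exact hv.injective_comp_right hyz
      · intro x hx
        simp only [Finset.mem_filter, Finset.mem_univ, true_and] at hx
        refine ⟨fun k => x (Function.surjInv hv k), Finset.mem_univ _, ?_⟩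
        ext i
        have : P (Function.surjInv hv (v i)) i := Function.surjInv_eq hv (v i)
        have := hx this
        rw [Setoid.ker_def] at this
        simp [this]
      · intros; rfl
    rw [h2, ← Finset.sum_fiberwise_of_maps_to (s := univ.filter (fun x : H r → Fin n => P ≤ Setoid.ker x))
      (t := univ.filter (fun Q => P ≤ Q)) (g := fun x => Setoid.ker x)]
    · refine Finset.sum_congr rfl fun Q hQ => ?_
      unfold S
      refine Finset.sum_congr ?_ fun _ _ => rfl
      ext x
      simp only [mem_K, Finset.mem_filter, Finset.mem_univ, true_and] at hQ ⊢
      constructor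
      · exact fun h => h.2
      · rintro rfl; exact ⟨hQ, rfl⟩
    · intro x hx; simpa using hx
  have h2 : ∀ Q ∈ B, Tendsto (fun n : ℕ => S n Q / (n : ℝ) ^ (2 * r)) atTop (𝓝 0) := by
    intro Q hQ
    have hQ' : Q ≠ P ∧ P ≤ Q := by simpa [hB] using hQ
    have hlt := cl_lt_of_lt hQ'.2 hQ'.1
    refine squeeze_zero_norm' (a := fun n : ℕ => 1 / (n : ℝ)) ?_ (tendsto_const_div_atTop_nhds_zero_nat 1)
    filter_upwards [eventually_gt_atTop 0] with n hn
    have hn' : (0 : ℝ) < n := by exact_mod_cast hn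
    rw [Real.norm_eq_abs, abs_div, abs_of_pos (pow_pos hn' _), div_le_div_iff₀ (by positivity) hn', one_mul]
    calc |S n Q| * n ≤ (n : ℝ) ^ (r + cl Q) * n := by gcongr; exact abs_S_le n Q
      _ = (n : ℝ) ^ (r + cl Q + 1) := by rw [pow_succ]
      _ ≤ _ := pow_le_pow_right₀ (by exact_mod_cast hn) (by omega)
  have h3 := h.sub (tendsto_finsetSum B h2)
  rw [Finset.sum_const_zero, sub_zero] at h3
  refine h3.congr fun n => ?_
  rw [h1, ← Finset.sum_div]; ring

end Gep
namespace Gep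
open Finset Filter Topology

/-- the sawtooth function on the cyclic group -/
noncomputable def saw {n : ℕ} (d : Fin n) : ℝ := if (d : ℕ) = 0 then 0 else (n : ℝ) - 2 * (d : ℕ)

lemma A_eq_saw {n : ℕ} [NeZero n] (a b : Fin n) : A a b = saw (b - a) := by
  unfold A saw
  rcases lt_trichotomy a b with h | h | h
  · have h' : (a : ℕ) < b := h
    have h1 : ((b - a : Fin n) : ℕ) = b - a := Fin.sub_val_of_le h.le
    rw [h1, if_neg (by omega), Nat.cast_sub h'.le]
    simp [sg, h]
  · simp [h, sg]
  · have h' : (b : ℕ) < a := h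
    have h1 : ((b - a : Fin n) : ℕ) = n + b - a := Fin.coe_sub_iff_lt.2 h
    have := a.2
    rw [h1, if_neg (by omega), Nat.cast_sub (by omega)]
    simp only [sg, h, h.not_gt, if_true, if_false]
    push_cast
    ring

/-- the square of the matrix -/
noncomputable def D {n : ℕ} (a c : Fin n) : ℝ := ∑ b : Fin n, A a b * A b c

lemma D_shift {n : ℕ} [NeZero n] (a c : Fin n) : D a c = D 0 (c - a) := by
  unfold D
  refine Fintype.sum_equiv (Equiv.subRight a) _ _ fun b => ?_
  simp [A_eq_saw]

lemma D_comm {n : ℕ} (a c : Fin n) : D c a = D a c := by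
  unfold D
  refine Finset.sum_congr rfl fun b _ => ?_
  rw [A_antisymm b c, A_antisymm a b]; ring

lemma sum_D_sq {n : ℕ} [NeZero n] : ∑ a : Fin n, ∑ c : Fin n, D a c ^ 2 = n * ∑ d : Fin n, D 0 d ^ 2 := by
  have : ∀ a : Fin n, ∑ c : Fin n, D a c ^ 2 = ∑ d : Fin n, D 0 d ^ 2 := by
    intro a
    refine Fintype.sum_equiv (Equiv.subRight a) _ _ fun b => ?_
    rw [D_shift]; rfl
  simp [this]

lemma D_diag {n : ℕ} [NeZero n] (a : Fin n) : D a a = - (n * (n - 1) * (n - 2) / 3) := by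
  rw [D_shift, sub_self]
  unfold D
  have h : ∀ b : Fin n, A 0 b * A b 0 = (if b = 0 then (n : ℝ) ^ 2 else 0)
      - ((n : ℝ) ^ 2 - 4 * n * (b : ℕ) + 4 * ((b : ℕ) : ℝ) ^ 2) := by
    intro b
    rw [A_antisymm 0 b, A_eq_saw 0 b, sub_zero]
    unfold saw
    by_cases hb : b = 0
    · simp [hb]
    · have : (b : ℕ) ≠ 0 := fun h => hb (Fin.ext (by simpa using h))
      simp only [hb, this, if_false]; ring
  simp_rw [h]
  rw [Finset.sum_sub_distrib, Finset.sum_ite_eq' univ (0 : Fin n), Finset.sum_add_distrib, Finset.sum_sub_distrib, ← Finset.mul_sum,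
    ← Finset.mul_sum, sum_id, sum_sq_id]
  simp
  ring

lemma D_step {n : ℕ} [NeZero n] (k : ℕ) (hk : k + 1 < n) (a : Fin n) :
    D a ⟨k + 1, hk⟩ = D a ⟨k, by omega⟩ + n * (A a ⟨k, by omega⟩ + A a ⟨k + 1, hk⟩) := by
  unfold D
  have h : ∀ b : Fin n, A a b * A b ⟨k + 1, hk⟩ = A a b * A b ⟨k, by omega⟩
     + ((if b = ⟨k, by omega⟩ then n * A a b else 0) + (if b = ⟨k + 1, hk⟩ then n * A a b else 0))
     - 2 * A a b := by
    intro b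
    have : A b ⟨k + 1, hk⟩ = A b ⟨k, by omega⟩ + ((if b = ⟨k, by omega⟩ then (n : ℝ) else 0)
      + (if b = ⟨k + 1, hk⟩ then (n : ℝ) else 0)) - 2 := by
      unfold A sg
      simp only [Fin.lt_def, Fin.ext_iff]
      rcases lt_trichotomy (b : ℕ) k with h | h | h
      · simp [h, h.ne, show (b : ℕ) < k + 1 by omega, show (b : ℕ) ≠ k + 1 by omega] <;> ring
      · simp [h] <;> ring
      · rcases eq_or_ne (b : ℕ) (k + 1) with h2 | h2
        · simp [h2]
        · simp [h.ne', h.not_gt, h, h2, show ¬ (b : ℕ) < k + 1 by omega, show k + 1 < (b : ℕ) by omega] <;> ring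
    rw [this]
    split_ifs <;> ring
  simp_rw [h]
  rw [Finset.sum_sub_distrib, Finset.sum_add_distrib, Finset.sum_add_distrib, Finset.sum_ite_eq',
    Finset.sum_ite_eq', ← Finset.mul_sum, row_sum]
  simp
  ring

lemma A_zero {n : ℕ} [NeZero n] (k : ℕ) (hk : k + 1 < n) : A 0 (⟨k + 1, hk⟩ : Fin n) = n - 2 * (k + 1) := by
  rw [A_eq_saw]; simp [saw]

lemma D_zero {n : ℕ} [NeZero n] (k : ℕ) (hk : k + 1 < n) :
    D 0 (⟨k + 1, hk⟩ : Fin n) = n * (2 * (k + 1) * n - n - 2 * (k + 1) ^ 2) - n * (n - 1) * (n - 2) / 3 := by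
  induction k with
  | zero =>
    rw [D_step]
    have : (⟨0, by omega⟩ : Fin n) = 0 := rfl
    rw [this, D_diag, A_self, A_zero]
    push_cast; ring
  | succ k ih =>
    rw [D_step, ih, A_zero, A_zero]
    push_cast; ring

lemma sum_D0_sq {n : ℕ} [NeZero n] : ∑ d : Fin n, D 0 d ^ 2 =
    (n : ℝ) ^ 7 / 45 - 4 * (n : ℝ) ^ 5 / 9 + (n : ℝ) ^ 4 - 26 * (n : ℝ) ^ 3 / 45 := by
  have h : ∀ d : Fin n, D 0 d ^ 2 = (n * (2 * (d : ℕ) * n - n - 2 * ((d : ℕ) : ℝ) ^ 2) - n * (n - 1) * (n - 2) / 3 : ℝ) ^ 2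
     - (if d = 0 then (n * (- n) - n * (n - 1) * (n - 2) / 3 : ℝ) ^ 2 - (n * (n - 1) * (n - 2) / 3 : ℝ) ^ 2 else 0) := by
    rintro ⟨k, hk⟩
    rcases k with _ | k
    · have : (⟨0, hk⟩ : Fin n) = 0 := rfl
      rw [this, D_diag]; simp
    · have : (⟨k + 1, hk⟩ : Fin n) ≠ 0 := by simp [Fin.ext_iff]
      rw [D_zero, if_neg this]
      push_cast; ring
  simp_rw [h]
  rw [Finset.sum_sub_distrib, Finset.sum_ite_eq']
  simp only [Finset.mem_univ, if_true]
  rw [Fin.sum_univ_eq_sum_range (fun k => (n * (2 * (k : ℝ) * n - n - 2 * (k : ℝ) ^ 2) - n * (n - 1) * (n - 2) / 3 : ℝ) ^ 2)]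
  have key : ∀ (N c : ℝ) (m : ℕ), ∑ k ∈ Finset.range m, (N * (2 * (k : ℝ) * N - N - 2 * (k : ℝ) ^ 2) - c) ^ 2
      = (N ^ 2 + c) ^ 2 * m - 4 * N ^ 2 * (N ^ 2 + c) * (m * (m - 1) / 2)
        + (4 * N ^ 4 + 4 * N * (N ^ 2 + c)) * (m * (m - 1) * (2 * m - 1) / 6)
        - 8 * N ^ 3 * (m ^ 2 * (m - 1) ^ 2 / 4)
        + 4 * N ^ 2 * (m * (m - 1) * (2 * m - 1) * (3 * m ^ 2 - 3 * m - 1) / 30) := by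
    intro N c m
    induction m with
    | zero => simp
    | succ m ih => rw [Finset.sum_range_succ, ih]; push_cast; ring
  rw [key]
  ring

lemma trace4 {n : ℕ} [NeZero n] :
    ∑ a : Fin n, ∑ b : Fin n, ∑ c : Fin n, ∑ d : Fin n, A a b * A b c * A c d * A d a
      = (n : ℝ) ^ 8 / 45 - 4 * (n : ℝ) ^ 6 / 9 + (n : ℝ) ^ 5 - 26 * (n : ℝ) ^ 4 / 45 := by
  have h : ∑ a : Fin n, ∑ b : Fin n, ∑ c : Fin n, ∑ d : Fin n, A a b * A b c * A c d * A d a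
    = ∑ a : Fin n, ∑ c : Fin n, D a c ^ 2 := by
    refine Finset.sum_congr rfl fun a _ => ?_
    rw [Finset.sum_comm]
    refine Finset.sum_congr rfl fun c _ => ?_
    rw [sq]
    nth_rewrite 2 [← D_comm]
    unfold D
    rw [Finset.sum_mul_sum]
    refine Finset.sum_congr rfl fun b _ => Finset.sum_congr rfl fun d _ => ?_
    ring
  rw [h, sum_D_sq, sum_D0_sq]
  ring

lemma trace2 {n : ℕ} [NeZero n] :
    ∑ a : Fin n, ∑ b : Fin n, A a b * A b a = - ((n : ℝ) ^ 2 * (n - 1) * (n - 2) / 3) := by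
  have : ∀ a : Fin n, ∑ b : Fin n, A a b * A b a = - (n * (n - 1) * (n - 2) / 3 : ℝ) := D_diag
  simp [this]
  ring

lemma tendsto_inv_nat : Tendsto (fun n : ℕ => ((n : ℝ))⁻¹) atTop (𝓝 0) := tendsto_inv_atTop_nhds_zero_nat

lemma lim_trace4 : Tendsto (fun n : ℕ =>
    (∑ a : Fin n, ∑ b : Fin n, ∑ c : Fin n, ∑ d : Fin n, A a b * A b c * A c d * A d a) / (n : ℝ) ^ 8)
    atTop (𝓝 (1 / 45)) := by
  have h : Tendsto (fun n : ℕ => 1 / 45 - 4 / 9 * ((n : ℝ))⁻¹ ^ 2 + ((n : ℝ))⁻¹ ^ 3 - 26 / 45 * ((n : ℝ))⁻¹ ^ 4)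
      atTop (𝓝 (1 / 45 - 4 / 9 * 0 ^ 2 + 0 ^ 3 - 26 / 45 * 0 ^ 4)) :=
    ((tendsto_const_nhds.sub ((tendsto_inv_nat.pow 2).const_mul _)).add (tendsto_inv_nat.pow 3)).sub
      ((tendsto_inv_nat.pow 4).const_mul _)
  norm_num at h
  norm_num
  refine h.congr' ?_
  filter_upwards [eventually_gt_atTop 0] with n hn
  haveI : NeZero n := ⟨hn.ne'⟩
  have hn' : (n : ℝ) ≠ 0 := by positivity
  rw [trace4]
  field_simp

lemma lim_trace2 : Tendsto (fun n : ℕ =>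
    (∑ a : Fin n, ∑ b : Fin n, A a b * A b a) / (n : ℝ) ^ 4) atTop (𝓝 (- (1 / 3))) := by
  have h : Tendsto (fun n : ℕ => - ((1 - ((n : ℝ))⁻¹) * (1 - 2 * ((n : ℝ))⁻¹) / 3))
      atTop (𝓝 (- ((1 - 0) * (1 - 2 * 0) / 3))) :=
    (((tendsto_const_nhds.sub tendsto_inv_nat).mul (tendsto_const_nhds.sub (tendsto_inv_nat.const_mul _))).div_const _).neg
  rw [show (- (1 / 3) : ℝ) = - ((1 - 0) * (1 - 2 * 0) / 3) by norm_num]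
  refine h.congr' ?_
  filter_upwards [eventually_gt_atTop 0] with n hn
  haveI : NeZero n := ⟨hn.ne'⟩
  have hn' : (n : ℝ) ≠ 0 := by positivity
  rw [trace2]
  field_simp

/-- label maps of the cyclic pairings -/
def v2 : H 2 → Fin 2 := fun h => if h.2 then h.1 + 1 else h.1
/-- 4-cycle -/
def v4 : H 4 → Fin 4 := fun h => if h.2 then h.1 + 1 else h.1
/-- two 2-cycles -/
def v22 : H 4 → Fin 4 := fun h => if h.2 then ![1, 0, 3, 2] h.1 else h.1

lemma v2_surj : Function.Surjective v2 := fun k => ⟨(k, false), rfl⟩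
lemma v4_surj : Function.Surjective v4 := fun k => ⟨(k, false), rfl⟩
lemma v22_surj : Function.Surjective v22 := fun k => ⟨(k, false), rfl⟩

/-- four coordinates -/
def four (α : Type) : (Fin 4 → α) ≃ α × α × α × α where
  toFun y := (y 0, y 1, y 2, y 3)
  invFun p := ![p.1, p.2.1, p.2.2.1, p.2.2.2]
  left_inv y := by ext i; fin_cases i <;> rfl
  right_inv p := rfl

lemma sum_four {n : ℕ} (φ : Fin n → Fin n → Fin n → Fin n → ℝ) :
    ∑ y : Fin 4 → Fin n, φ (y 0) (y 1) (y 2) (y 3) = ∑ a, ∑ b, ∑ c, ∑ d, φ a b c d := by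
  refine (Fintype.sum_equiv (four (Fin n)) _ (fun p => φ p.1 p.2.1 p.2.2.1 p.2.2.2) (fun y => rfl)).trans ?_
  simp_rw [Fintype.sum_prod_type]

lemma sum_two {n : ℕ} (φ : Fin n → Fin n → ℝ) :
    ∑ y : Fin 2 → Fin n, φ (y 0) (y 1) = ∑ a, ∑ b, φ a b := by
  refine (Fintype.sum_equiv (finTwoArrowEquiv (Fin n)) _ (fun p => φ p.1 p.2) (fun y => rfl)).trans ?_
  simp_rw [Fintype.sum_prod_type]

lemma lim_v2 : Tendsto (fun n : ℕ => S n (Setoid.ker v2) / (n : ℝ) ^ (2 * 2)) atTop (𝓝 (- (1 / 3))) := by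
  apply tendsto_S_of_full v2 v2_surj
  refine lim_trace2.congr fun n => ?_
  rw [← sum_two]
  congr 1
  refine Finset.sum_congr rfl fun y _ => ?_
  simp [F, v2, Fin.prod_univ_two]

lemma lim_v4 : Tendsto (fun n : ℕ => S n (Setoid.ker v4) / (n : ℝ) ^ (2 * 4)) atTop (𝓝 (1 / 45)) := by
  apply tendsto_S_of_full v4 v4_surj
  refine lim_trace4.congr fun n => ?_
  rw [← sum_four (fun a b c d => A a b * A b c * A c d * A d a)]
  congr 1
  refine Finset.sum_congr rfl fun y _ => ?_
  simp [F, v4, Fin.prod_univ_four]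

lemma lim_v22 : Tendsto (fun n : ℕ => S n (Setoid.ker v22) / (n : ℝ) ^ (2 * 4)) atTop (𝓝 (1 / 9)) := by
  apply tendsto_S_of_full v22 v22_surj
  have h := lim_trace2.pow 2
  norm_num at h
  norm_num
  refine h.congr fun n => ?_
  rw [div_pow, ← pow_mul]
  congr 1
  have : ∑ y : Fin 4 → Fin n, F (y ∘ v22)
    = ∑ y : Fin 4 → Fin n, (fun a b c d => (A a b * A b a) * (A c d * A d c)) (y 0) (y 1) (y 2) (y 3) := by
    refine Finset.sum_congr rfl fun y _ => ?_
    simp [F, v22, Fin.prod_univ_four]; ring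
  rw [this, sum_four (fun a b c d => (A a b * A b a) * (A c d * A d c))]
  simp_rw [← Finset.mul_sum, ← Finset.sum_mul]
  rw [sq]

end Gep
namespace Gep
open Finset Filter Topology

lemma moment_limit {r : ℕ} (hr : 0 < r) {ι : Type} [Fintype ι] (lab : ι → H r → Fin r) (val : ι → ℝ)
    (hinj : ∀ q q', (∀ i j, lab q i = lab q j ↔ lab q' i = lab q' j) → q = q')
    (hsurj : ∀ q, Function.Surjective (lab q))
    (hlim : ∀ q, Tendsto (fun n : ℕ => S n (Setoid.ker (lab q)) ^ 2 / ((K n (Setoid.ker (lab q))).card : ℝ)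
      / (n : ℝ) ^ (3 * r)) atTop (𝓝 (val q)))
    (hcover : ∀ σ : H r → H r, (∀ i, σ i ≠ i) → (∀ i, σ (σ i) = i) →
      (∀ e, σ (e, false) ≠ (e, true)) → ∃ q, ∀ i, lab q (σ i) = lab q i) :
    Tendsto (fun n : ℕ => (∑ P : Setoid (H r), S n P ^ 2 / ((K n P).card : ℝ)) / (n : ℝ) ^ (3 * r))
      atTop (𝓝 (∑ q, val q)) := by
  classical
  have hi : Function.Injective (fun q => Setoid.ker (lab q)) := by
    intro q q' h
    apply hinj
    intro i j
    have := congrArg (fun s : Setoid (H r) => s i j) h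
    simpa [Setoid.ker_def] using this
  set B := univ.image (fun q => Setoid.ker (lab q)) with hB
  have hout : ∀ P ∈ Bᶜ, Tendsto (fun n : ℕ => S n P ^ 2 / ((K n P).card : ℝ)
      / (n : ℝ) ^ (3 * r)) atTop (𝓝 0) := by
    intro P hP
    by_cases hlt : cl P < r + (sing P).card
    · exact tendsto_nonpair hr P hlt
    obtain ⟨hc, σ, hσ, hPσ⟩ := pairing_of_not_lt P hlt
    by_cases hloop : ∃ e, σ (e, false) = (e, true)
    · obtain ⟨e, he⟩ := hloop
      have : ∀ n, S n P = 0 := fun n => S_loop n P e ((hPσ _ _).2 (Or.inr he.symm))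
      simp [this]
    · push Not at hloop
      have hinv : ∀ i, σ (σ i) = i := by
        intro i
        have : P (σ i) i := P.symm' ((hPσ i (σ i)).2 (Or.inr rfl))
        rcases (hPσ _ _).1 this with h | h
        · exact absurd h.symm (hσ i)
        · exact h.symm
      obtain ⟨q, hq⟩ := hcover σ hσ hinv hloop
      exfalso
      have hle : P ≤ Setoid.ker (lab q) := by
        intro i j hij
        rw [Setoid.ker_def]
        rcases (hPσ _ _).1 hij with h | h
        · rw [h]
        · rw [h, hq]
      have hPe : Setoid.ker (lab q) = P := by
        by_contra hne
        have := cl_lt_of_lt hle hne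
        rw [cl_ker _ (hsurj q)] at this
        omega
      have : P ∈ B := by rw [hB, Finset.mem_image]; exact ⟨q, Finset.mem_univ _, hPe⟩
      simp [this] at hP
  have h1 := (tendsto_finsetSum univ (fun q _ => hlim q)).add (tendsto_finsetSum Bᶜ hout)
  rw [Finset.sum_const_zero, add_zero] at h1
  refine h1.congr fun n => ?_
  rw [Finset.sum_div, ← Finset.sum_add_sum_compl B, hB, Finset.sum_image hi.injOn]

lemma lim_gmap {r : ℕ} (v : H r → Fin r) (hv : Function.Surjective v) (c : ℝ)
    (h : Tendsto (fun n : ℕ => S n (Setoid.ker v) / (n : ℝ) ^ (2 * r)) atTop (𝓝 c))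
    (p : Equiv.Perm (Fin r)) (f : Fin r → Bool) :
    Tendsto (fun n : ℕ => S n (Setoid.ker (v ∘ gmap p f)) ^ 2 / ((K n (Setoid.ker (v ∘ gmap p f))).card : ℝ)
      / (n : ℝ) ^ (3 * r)) atTop (𝓝 (c ^ 2)) := by
  have := tendsto_pair _ (cl_ker v hv) c h
  refine this.congr fun n => ?_
  rw [S_gmap, card_K_gmap _ _ _ _ hv]

/-- labels for r = 2 -/
def lab2 (q : Bool) : H 2 → Fin 2 := v2 ∘ gmap 1 ![false, q]

/-- parameters for r = 4 -/
abbrev Q4 := (Fin 3 × Fin 2 × Bool × Bool × Bool) ⊕ (Fin 3 × Bool × Bool)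

/-- labels for r = 4 -/
def lab4 : Q4 → H 4 → Fin 4
  | Sum.inl (a, b, f1, f2, f3) =>
      v4 ∘ gmap (Equiv.swap 1 (![1, 2, 3] a) * Equiv.swap 2 (![2, 3] b)) ![false, f1, f2, f3]
  | Sum.inr (a, f1, f3) =>
      v22 ∘ gmap (Equiv.swap 1 (![1, 2, 3] a)) (fun e => ![false, f1, false, f3] (Equiv.swap 1 (![1, 2, 3] a) e))

end Gep
namespace Gep

/-- exhaustive search over loop-free pairings, with pruning -/
def search {r : ℕ} {ι : Type} [Fintype ι] (lab : ι → H r → Fin r) : List (H r) → List (H r × H r) → Bool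
  | [], asg => decide (∃ q : ι, asg.all (fun p => decide (lab q p.2 = lab q p.1)) = true)
  | h :: hs, asg => decide (∀ a : H r, (decide (a.1 = h.1)
      || asg.any (fun p => decide (p.2 = h) != decide (a = p.1))) = true ∨
        search lab hs ((h, a) :: asg) = true)

lemma search_sound {r : ℕ} {ι : Type} [Fintype ι] (lab : ι → H r → Fin r) (σ : H r → H r)
    (hσ : ∀ i, σ i ≠ i) (hinv : ∀ i, σ (σ i) = i) (hloop : ∀ e, σ (e, false) ≠ (e, true)) :
    ∀ (hs : List (H r)) (asg : List (H r × H r)), (∀ p ∈ asg, p.2 = σ p.1) →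
      search lab hs asg = true →
      ∃ q, (∀ p ∈ asg, lab q p.2 = lab q p.1) ∧ ∀ h ∈ hs, lab q (σ h) = lab q h := by
  intro hs
  induction hs with
  | nil =>
    intro asg _ h
    simpa [search] using h
  | cons h hs ih =>
    intro asg hasg hh
    rw [search, decide_eq_true_eq] at hh
    have h1 : (σ h).1 ≠ h.1 := by
      obtain ⟨e, b⟩ := h
      intro he
      cases b
      · rcases hb : (σ (e, false)).2 with _ | _
        · exact hσ (e, false) (Prod.ext he hb)
        · exact hloop e (Prod.ext he hb)
      · rcases hb : (σ (e, true)).2 with _ | _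
        · have h2 : σ (e, true) = (e, false) := Prod.ext he hb
          have h3 := hinv (e, true)
          rw [h2] at h3
          exact hloop e h3
        · exact hσ (e, true) (Prod.ext he hb)
    rcases hh (σ h) with h2 | h2
    · exfalso
      rw [Bool.or_eq_true, decide_eq_true_eq] at h2
      rcases h2 with h2 | h2
      · exact h1 h2
      · rw [List.any_eq_true] at h2
        obtain ⟨p, hp, hne⟩ := h2
        have hp2 := hasg p hp
        have : (p.2 = h) ↔ (σ h = p.1) := by
          rw [hp2]
          constructor
          · intro h'; rw [← h', hinv]
          · intro h'; rw [← h', hinv]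
        simp [this] at hne
    · obtain ⟨q, hq1, hq2⟩ := ih _ (by
        intro p hp
        rcases List.mem_cons.1 hp with rfl | hp
        · rfl
        · exact hasg p hp) h2
      refine ⟨q, fun p hp => hq1 p (List.mem_cons_of_mem _ hp), ?_⟩
      intro i hi
      rcases List.mem_cons.1 hi with rfl | hi
      · exact hq1 (i, σ i) (by simp)
      · exact hq2 i hi

lemma search2 : search lab2 [(0, false), (0, true), (1, false), (1, true)] [] = true := by
  decide +kernel

lemma search4 : search lab4 [(0, false), (0, true), (1, false), (1, true), (2, false), (2, true),
    (3, false), (3, true)] [] = true := by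
  decide +kernel

instance decA (q q' : Q4) : Decidable (∀ i j, lab4 q i = lab4 q j ↔ lab4 q' i = lab4 q' j) :=
  inferInstance
instance decB (q q' : Q4) :
    Decidable ((∀ i j, lab4 q i = lab4 q j ↔ lab4 q' i = lab4 q' j) → q = q') := inferInstance
instance decC : Decidable (∀ q q' : Q4,
    (∀ i j, lab4 q i = lab4 q j ↔ lab4 q' i = lab4 q' j) → q = q') := inferInstance

lemma inj4 : ∀ q q' : Q4, (∀ i j, lab4 q i = lab4 q j ↔ lab4 q' i = lab4 q' j) → q = q' := by
  decide +kernel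

lemma inj2 : ∀ q q' : Bool, (∀ i j, lab2 q i = lab2 q j ↔ lab2 q' i = lab2 q' j) → q = q' := by
  decide +kernel

open Finset Filter Topology

lemma surj_gmap {r : ℕ} (v : H r → Fin r) (hv : Function.Surjective v)
    (p : Equiv.Perm (Fin r)) (f : Fin r → Bool) : Function.Surjective (v ∘ gmap p f) :=
  hv.comp (gEquiv p f).surjective

lemma moment2 : Tendsto (fun n : ℕ => (∑ P : Setoid (H 2), S n P ^ 2 / ((K n P).card : ℝ))
    / (n : ℝ) ^ (3 * 2)) atTop (𝓝 (2 / 9)) := by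
  have := moment_limit (r := 2) (by norm_num) lab2 (fun _ => (-(1 / 3) : ℝ) ^ 2) inj2
    (fun q => surj_gmap _ v2_surj _ _) (fun q => lim_gmap v2 v2_surj _ lim_v2 _ _)
    (by
      intro σ h1 h2 h3
      obtain ⟨q, -, hq⟩ := search_sound lab2 σ h1 h2 h3 _ [] (by simp) search2
      refine ⟨q, fun i => hq i ?_⟩
      revert i; decide)
  convert this using 2
  simp
  norm_num

lemma moment4 : Tendsto (fun n : ℕ => (∑ P : Setoid (H 4), S n P ^ 2 / ((K n P).card : ℝ))
    / (n : ℝ) ^ (3 * 4)) atTop (𝓝 (48 / 2025 + 12 / 81)) := by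
  have := moment_limit (r := 4) (by norm_num) lab4
    (Sum.elim (fun _ => (1 / 45 : ℝ) ^ 2) (fun _ => (1 / 9 : ℝ) ^ 2)) inj4
    (by
      rintro (⟨a, b, f1, f2, f3⟩ | ⟨a, f1, f3⟩)
      · exact surj_gmap _ v4_surj _ _
      · exact surj_gmap _ v22_surj _ _)
    (by
      rintro (⟨a, b, f1, f2, f3⟩ | ⟨a, f1, f3⟩)
      · exact lim_gmap v4 v4_surj _ lim_v4 _ _
      · exact lim_gmap v22 v22_surj _ lim_v22 _ _)
    (by
      intro σ h1 h2 h3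
      obtain ⟨q, -, hq⟩ := search_sound lab4 σ h1 h2 h3 _ [] (by simp) search4
      refine ⟨q, fun i => hq i ?_⟩
      revert i; decide)
  convert this using 2
  rw [Fintype.sum_sum_type]
  simp [Fintype.card_prod]
  norm_num

end Gep

theorem gep_perm_limiting_kurtosis :
    Filter.Tendsto (fun n => m 4 n / (m 2 n) ^ 2) Filter.atTop (nhds (87 / 25 : ℝ))
      ∧ (87 / 25 : ℝ) ≠ 3 := by
  refine ⟨?_, by norm_num⟩
  have h := Gep.moment4.div (Gep.moment2.pow 2) (by norm_num)
  have e : ((48 / 2025 + 12 / 81) / (2 / 9) ^ 2 : ℝ) = 87 / 25 := by norm_num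
  rw [e] at h
  refine h.congr' ?_
  filter_upwards [Filter.eventually_gt_atTop 0] with n hn
  have hn' : (n : ℝ) ≠ 0 := by positivity
  simp only [Pi.div_apply, Pi.pow_apply]
  rw [Gep.m_eq 4 n hn, Gep.m_eq 2 n hn]
  generalize (∑ P : Setoid (Gep.H 4), Gep.S n P ^ 2 / ((Gep.K n P).card : ℝ)) = x
  generalize (∑ P : Setoid (Gep.H 2), Gep.S n P ^ 2 / ((Gep.K n P).card : ℝ)) = y
  by_cases hy : y = 0
  · simp [hy]
  have h4 : ((-1 / (4 * (n : ℝ))) ^ 4 : ℝ) ≠ 0 := by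
    refine pow_ne_zero _ (div_ne_zero (by norm_num) (by positivity))
  have e1 : ((-1 / (4 * (n : ℝ))) ^ 2 * y) ^ 2 = (-1 / (4 * (n : ℝ))) ^ 4 * y ^ 2 := by ring
  rw [e1, mul_div_mul_left _ _ h4]
  field_simp
  ring
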